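/- arXiv:2505.05362 — 12 statements merged into one kernel-verified Lean document; each statement's English description precedes it below -/
import Mathlib

section
/- For every neuron N, input list inp : List (ℕ → Bool), and len : ℕ, if is_initial(N, len) and w_N(id) ≥ 0 for every id < len, then CurPot_N(inp, len) ≥ 0. -/
structure NeuronFeature where
  Id : ℕ
  Weights : ℕ → ℚ
  Leak_Factor : ℚ
  Tau : ℚ
  LeakRange : 0 ≤ Leak_Factor ∧ Leak_Factor ≤ 1
  PosTau : 0 < Tau
  WRange : ∀ x, -1 ≤ Weights x ∧ Weights x ≤ 1
  WId : Weights Id = 0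

structure Neuron where
  Output : List Bool
  CurPot : ℚ
  Feature : NeuronFeature
  CurPot_Output : decide (Feature.Tau ≤ CurPot) = Output.headD false

def potential (ws : ℕ → ℚ) (inp : ℕ → Bool) : ℕ → ℚ
  | 0 => 0
  | m + 1 => if inp m then potential ws inp m + ws m else potential ws inp m

def NextPotential (N : Neuron) (inp : ℕ → Bool) (len : ℕ) : ℚ :=
  if N.Feature.Tau ≤ N.CurPot then potential N.Feature.Weights inp len
  else potential N.Feature.Weights inp len + N.Feature.Leak_Factor * N.CurPot

def NextNeuron (inp : ℕ → Bool) (len : ℕ) (N : Neuron) : Neuron :=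
  ⟨decide (N.Feature.Tau ≤ NextPotential N inp len) :: N.Output,
   NextPotential N inp len, N.Feature, rfl⟩

def AfterNstepsNeuron (N : Neuron) (inp : List (ℕ → Bool)) (len : ℕ) : Neuron :=
  match inp with
  | [] => N
  | i :: tl => NextNeuron i len (AfterNstepsNeuron N tl len)

def SetNeuron (nf : NeuronFeature) : Neuron :=
  ⟨[false], 0, nf, by simp [not_le.mpr nf.PosTau]⟩

def EquivFeature (nf1 nf2 : NeuronFeature) (len : ℕ) : Prop :=
  nf1.Id = nf2.Id ∧ (∀ id, id < len → nf1.Weights id = nf2.Weights id) ∧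
    nf1.Leak_Factor = nf2.Leak_Factor ∧ nf1.Tau = nf2.Tau

def EquivNeuron (n1 n2 : Neuron) (len : ℕ) : Prop :=
  EquivFeature n1.Feature n2.Feature len ∧ n1.Output = n2.Output ∧ n1.CurPot = n2.CurPot

def is_initial_neuro (n : Neuron) (len : ℕ) : Prop :=
  ∃ nf : NeuronFeature, EquivNeuron n (SetNeuron nf) len

def One_Input_Or_Less (nf : NeuronFeature) (id len : ℕ) : Prop :=
  id < len ∧ ∀ id', id ≠ id' → id' < len → nf.Weights id' = 0

def inpSI (inp : List Bool) : List (ℕ → Bool) :=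
  inp.map (fun b _ => b)

structure NeuroCircuit where
  Time : ℕ
  ListNeuro : List Neuron
  SupplInput : ℕ
  IdNeuroDiff : ListNeuro.Pairwise (fun a b => a.Feature.Id ≠ b.Feature.Id)
  IdInfLen : ∀ n ∈ ListNeuro, n.Feature.Id < ListNeuro.length
  TimeNeuro : ∀ n ∈ ListNeuro, n.Output.length = Time + 1

def lenNC (nc : NeuroCircuit) : ℕ := nc.ListNeuro.length + nc.SupplInput

def output_neuron_init (nc : NeuroCircuit) (id : ℕ) : List Bool :=
  match nc.ListNeuro.find? (fun x => x.Feature.Id == id) with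
  | some x => x.Output
  | none => []

def NextNeuroInNC (nc : NeuroCircuit) (inp : ℕ → Bool) : Neuron → Neuron :=
  NextNeuron
    (fun x => if x < nc.ListNeuro.length then (output_neuron_init nc x).headD false else inp x)
    (lenNC nc)

def NextListNeuro (nc : NeuroCircuit) (inp : ℕ → Bool) : List Neuron :=
  nc.ListNeuro.map (NextNeuroInNC nc inp)

def NextStepC (nc : NeuroCircuit) (inp : ℕ → Bool) : NeuroCircuit where
  Time := nc.Time + 1
  ListNeuro := NextListNeuro nc inp
  SupplInput := nc.SupplInput
  IdNeuroDiff := by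
    unfold NextListNeuro
    exact nc.IdNeuroDiff.map _ (fun a b h => h)
  IdInfLen := by
    intro n hn
    unfold NextListNeuro at hn ⊢
    rw [List.mem_map] at hn
    obtain ⟨m, hm, rfl⟩ := hn
    simpa [NextNeuroInNC, NextNeuron] using nc.IdInfLen m hm
  TimeNeuro := by
    intro n hn
    unfold NextListNeuro at hn
    rw [List.mem_map] at hn
    obtain ⟨m, hm, rfl⟩ := hn
    simp [NextNeuroInNC, NextNeuron, nc.TimeNeuro m hm]

def Nstepscircuit (nc : NeuroCircuit) (inp : List (ℕ → Bool)) : NeuroCircuit :=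
  match inp with
  | [] => nc
  | h :: tl => NextStepC (Nstepscircuit nc tl) h

def output_neuron (nc : NeuroCircuit) (inp : List (ℕ → Bool)) (id : ℕ) : List Bool :=
  match (Nstepscircuit nc inp).ListNeuro.find? (fun x => x.Feature.Id == id) with
  | some x => x.Output
  | none => []

def curpot_neuron (nc : NeuroCircuit) (inp : List (ℕ → Bool)) (id : ℕ) : ℚ :=
  match (Nstepscircuit nc inp).ListNeuro.find? (fun x => x.Feature.Id == id) with
  | some x => x.CurPot
  | none => 0

def is_initial_Cir (nc : NeuroCircuit) : Prop :=
  ∀ n ∈ nc.ListNeuro, ∃ nf : NeuronFeature, EquivNeuron n (SetNeuron nf) (lenNC nc)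

def repeat_pattern (l : List Bool) (n : ℕ) : List Bool :=
  if l = [] then []
  else (List.range n).map (fun i => l.getD ((n - 1 - i) % l.length) false)

theorem aux_potential (ws : ℕ → ℚ) (inp : ℕ → Bool) (len : ℕ)
    (hw : ∀ id, id < len → 0 ≤ ws id) : 0 ≤ potential ws inp len := by
  induction len with
  | zero => exact le_refl _
  | succ m ih =>
    have h1 := ih (fun id h => hw id (by omega))
    have h2 := hw m (by omega)
    unfold potential
    split_ifs
    · exact add_nonneg h1 h2
    · exact h1

theorem aux_feature (N : Neuron) (inp : List (ℕ → Bool)) (len : ℕ) :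
    (AfterNstepsNeuron N inp len).Feature = N.Feature := by
  induction inp with
  | nil => rfl
  | cons i tl ih => exact ih

theorem Always_N_Neg (N : Neuron) (inp : List (ℕ → Bool)) (len : ℕ)
    (hinit : is_initial_neuro N len)
    (hw : ∀ id, id < len → 0 ≤ N.Feature.Weights id) :
    0 ≤ (AfterNstepsNeuron N inp len).CurPot := by
  have h0 : N.CurPot = 0 := by
    obtain ⟨nf, _, _, h⟩ := hinit
    exact h
  induction inp with
  | nil => exact h0.ge
  | cons i tl ih =>
    have hf := aux_feature N tl len
    have hp := aux_potential N.Feature.Weights i len hw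
    show 0 ≤ NextPotential (AfterNstepsNeuron N tl len) i len
    unfold NextPotential
    rw [hf]
    split_ifs
    · exact hp
    · exact add_nonneg hp (mul_nonneg N.Feature.LeakRange.1 ih)
end

section
/- For every neuron N, input list inp : List (ℕ → Bool), and len : ℕ, if is_initial(N, len) and w_N(id) ≤ 0 for every id < len, then every element of the list Output_N(inp, len) equals false (the neuron never fires). -/
theorem potential_nonpos_aux (ws : ℕ → ℚ) (inp : ℕ → Bool) (len : ℕ)
    (hw : ∀ id, id < len → ws id ≤ 0) : potential ws inp len ≤ 0 := by
  induction len with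
  | zero => simp [potential]
  | succ m ih =>
    have h1 := ih (fun id h => hw id (by omega))
    have h2 := hw m (by omega)
    unfold potential
    split_ifs <;> linarith

theorem inhibitor_aux (N : Neuron) (inp : List (ℕ → Bool)) (len : ℕ)
    (hinit : is_initial_neuro N len)
    (hw : ∀ id, id < len → N.Feature.Weights id ≤ 0) :
    (AfterNstepsNeuron N inp len).Feature = N.Feature ∧
    (AfterNstepsNeuron N inp len).CurPot ≤ 0 ∧
    ∀ a ∈ (AfterNstepsNeuron N inp len).Output, a = false := by
  induction inp with
  | nil =>
    obtain ⟨nf, _, ho, hc⟩ := hinit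
    simp [AfterNstepsNeuron, ho, hc, SetNeuron]
  | cons i tl ih =>
    obtain ⟨hf, hp, ho⟩ := ih
    have hn : NextPotential (AfterNstepsNeuron N tl len) i len ≤ 0 := by
      have h1 := potential_nonpos_aux N.Feature.Weights i len hw
      have h2 := mul_nonpos_of_nonneg_of_nonpos N.Feature.LeakRange.1 hp
      unfold NextPotential
      rw [hf]
      split_ifs <;> linarith
    refine ⟨hf, hn, ?_⟩
    intro a ha
    rcases List.mem_cons.mp ha with h | h
    · rw [h, hf]
      exact decide_eq_false (not_le.mpr (lt_of_le_of_lt hn N.Feature.PosTau))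
    · exact ho a h

theorem Inhibitor_Effect (N : Neuron) (inp : List (ℕ → Bool)) (len : ℕ)
    (hinit : is_initial_neuro N len)
    (hw : ∀ id, id < len → N.Feature.Weights id ≤ 0) :
    ∀ a ∈ (AfterNstepsNeuron N inp len).Output, a = false := by 
  exact (inhibitor_aux N inp len hinit hw).2.2
end

section
/- For every neuron N, identifier id : ℕ, len : ℕ, Boolean i, and input sequence inp : List Bool, if One_input(N, id, len), is_initial(N, len), and τ_N ≤ w_N(id), then Output_N(i :: inp, len) = i :: Output_N(inp, len). -/
theorem pot_false_aux (w : ℕ → ℚ) (len : ℕ) : potential w (fun _ => false) len = 0 := by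
  induction len with
  | zero => rfl
  | succ m ih => simp [potential, ih]

theorem pot_true_zero_aux (w : ℕ → ℚ) (len : ℕ) (h : ∀ x, x < len → w x = 0) :
    potential w (fun _ => true) len = 0 := by
  induction len with
  | zero => rfl
  | succ m ih =>
    simp [potential, ih (fun x hx => h x (by omega)), h m (by omega)]

theorem pot_true_aux (w : ℕ → ℚ) (id len : ℕ) (hid : id < len)
    (h : ∀ x, id ≠ x → x < len → w x = 0) :
    potential w (fun _ => true) len = w id := by
  induction len with
  | zero => omega
  | succ m ih =>
    by_cases hm : id = m
    · subst hm
      simp [potential, pot_true_zero_aux w id (fun x hx => h x (by omega) (by omega))]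
    · simp [potential, ih (by omega) (fun x h1 hx => h x h1 (by omega)), h m hm (by omega)]

theorem feature_aux (N : Neuron) (l : List (ℕ → Bool)) (len : ℕ) :
    (AfterNstepsNeuron N l len).Feature = N.Feature := by
  induction l with
  | nil => rfl
  | cons a t ih => simpa [AfterNstepsNeuron, NextNeuron] using ih

theorem curpot_aux (N : Neuron) (id len : ℕ) (inp : List Bool)
    (hone : One_Input_Or_Less N.Feature id len) (h0 : N.CurPot = 0)
    (hw : N.Feature.Tau ≤ N.Feature.Weights id) :
    0 ≤ (AfterNstepsNeuron N (inpSI inp) len).CurPot := by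
  induction inp with
  | nil => exact h0.ge
  | cons b t ih =>
    change 0 ≤ NextPotential (AfterNstepsNeuron N (inpSI t) len) (fun _ => b) len
    have hp := N.Feature.PosTau
    have hm := mul_nonneg N.Feature.LeakRange.1 ih
    unfold NextPotential
    rw [feature_aux]
    cases b
    · rw [pot_false_aux]
      split_ifs <;> linarith
    · rw [pot_true_aux _ id len hone.1 hone.2]
      split_ifs <;> linarith

theorem Output_cons_w_greater_tau_oi (N : Neuron) (id : ℕ) (len : ℕ) (i : Bool)
    (inp : List Bool)
    (hone : One_Input_Or_Less N.Feature id len)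
    (hinit : is_initial_neuro N len)
    (hw : N.Feature.Tau ≤ N.Feature.Weights id) :
    (AfterNstepsNeuron N (inpSI (i :: inp)) len).Output =
      i :: (AfterNstepsNeuron N (inpSI inp) len).Output := by
  have h0 : N.CurPot = 0 := by
    obtain ⟨nf, -, -, h⟩ := hinit
    exact h
  have hc := curpot_aux N id len inp hone h0 hw
  change decide ((AfterNstepsNeuron N (inpSI inp) len).Feature.Tau ≤
    NextPotential (AfterNstepsNeuron N (inpSI inp) len) (fun _ => i) len) :: _ = _
  congr 1
  have hp := N.Feature.PosTau
  have hm := mul_nonneg N.Feature.LeakRange.1 hc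
  have hm2 := mul_le_mul_of_nonneg_right N.Feature.LeakRange.2 hc
  unfold NextPotential
  rw [feature_aux]
  cases i
  · rw [pot_false_aux, decide_eq_false_iff_not, not_le]
    split_ifs with h
    · exact hp
    · rw [not_le] at h
      linarith
  · rw [pot_true_aux _ id len hone.1 hone.2, decide_eq_true_iff]
    split_ifs <;> linarith
end

section
/- (Delayer effect.) For every neuron N, identifier id : ℕ, input sequence inp : List Bool, and len : ℕ, if One_input(N, id, len), is_initial(N, len), and w_N(id) ≥ τ_N, then Output_N(inp, len) = inp ++ [false]. -/
theorem potential_const_false (ws : ℕ → ℚ) (len : ℕ) :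
    potential ws (fun _ => false) len = 0 := by
  induction len with
  | zero => rfl
  | succ m ih => simp [potential, ih]

theorem potential_const_true (ws : ℕ → ℚ) (id len : ℕ)
    (h : ∀ id', id ≠ id' → id' < len → ws id' = 0) :
    potential ws (fun _ => true) len = if id < len then ws id else 0 := by
  induction len with
  | zero => rfl
  | succ m ih =>
    have ih' := ih (fun a ha hl => h a ha (by omega))
    simp only [potential, if_true, ih']
    by_cases hm : id = m
    · subst hm
      simp
    · rw [h m hm (by omega), add_zero]
      have : (id < m) ↔ (id < m + 1) := by omega
      simp only [this]

theorem delayer_inv (N : Neuron) (id : ℕ) (inp : List Bool) (len : ℕ)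
    (hone : One_Input_Or_Less N.Feature id len)
    (ho : N.Output = [false]) (hc : N.CurPot = 0)
    (hw : N.Feature.Tau ≤ N.Feature.Weights id) :
    (AfterNstepsNeuron N (inpSI inp) len).Output = inp ++ [false] ∧
    (AfterNstepsNeuron N (inpSI inp) len).Feature = N.Feature ∧
    ((AfterNstepsNeuron N (inpSI inp) len).CurPot = 0 ∨
      N.Feature.Tau ≤ (AfterNstepsNeuron N (inpSI inp) len).CurPot) := by
  induction inp with
  | nil => exact ⟨ho, rfl, Or.inl hc⟩
  | cons b tl ih =>
    have e : AfterNstepsNeuron N (inpSI (b :: tl)) len =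
      NextNeuron (fun _ => b) len (AfterNstepsNeuron N (inpSI tl) len) := rfl
    rw [e]
    generalize AfterNstepsNeuron N (inpSI tl) len = M at ih
    obtain ⟨h1, h2, h3⟩ := ih
    have hp : NextPotential M (fun _ => b) len = potential N.Feature.Weights (fun _ => b) len := by
      unfold NextPotential
      rw [h2]
      split_ifs with h
      · rfl
      · rcases h3 with h3 | h3
        · simp [h3]
        · exact absurd h3 h
    have hpos := N.Feature.PosTau
    cases b with
    | false =>
      rw [potential_const_false] at hp
      simp [NextNeuron, hp, h1, h2, hpos]
    | true =>
      rw [potential_const_true _ id len hone.2, if_pos hone.1] at hp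
      simp [NextNeuron, hp, h1, h2, hw]

theorem Delayer_Effect (N : Neuron) (id : ℕ) (inp : List Bool) (len : ℕ)
    (hone : One_Input_Or_Less N.Feature id len)
    (hinit : is_initial_neuro N len)
    (hw : N.Feature.Tau ≤ N.Feature.Weights id) :
    (AfterNstepsNeuron N (inpSI inp) len).Output = inp ++ [false] := by 
  obtain ⟨nf, _, ho, hc⟩ := hinit
  exact (delayer_inv N id inp len hone ho hc hw).1
end

section
/- (Filtering effect.) For every neuron N, identifier id : ℕ, input sequence inp : List Bool, and len : ℕ, if One_input(N, id, len), is_initial(N, len), and w_N(id) < τ_N, then for all Booleans a₁, a₂ and lists l₁, l₂ : List Bool, if Output_N(inp, len) = l₁ ++ [a₁; a₂] ++ l₂, then a₁ = false or a₂ = false (the neuron never fires at two consecutive time steps). -/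
theorem aux_potential_s6 (ws : ℕ → ℚ) (inp : ℕ → Bool) (id : ℕ) (n : ℕ)
    (h : ∀ id', id ≠ id' → id' < n → ws id' = 0) :
    potential ws inp n = if id < n ∧ inp id = true then ws id else 0 := by
  induction n with
  | zero => simp [potential]
  | succ m ih =>
    have ih' := ih (fun i h1 h2 => h i h1 (by omega))
    rw [potential, ih']
    by_cases hm : id = m
    · subst hm
      by_cases hi : inp id = true <;> simp [hi]
    · have h0 := h m hm (by omega)
      have e : id < m + 1 ↔ id < m := by omega
      simp [h0, e]

theorem aux_chain (N : Neuron) (id : ℕ) (inp : List (ℕ → Bool)) (len : ℕ)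
    (hone : One_Input_Or_Less N.Feature id len)
    (hinit : is_initial_neuro N len)
    (hw : N.Feature.Weights id < N.Feature.Tau) :
    ∀ (a₁ a₂ : Bool) (l₁ l₂ : List Bool),
      (AfterNstepsNeuron N inp len).Output = l₁ ++ [a₁, a₂] ++ l₂ →
      a₁ = false ∨ a₂ = false := by
  induction inp with
  | nil =>
    intro a₁ a₂ l₁ l₂ h
    obtain ⟨nf, -, ho, -⟩ := hinit
    have hl := congrArg List.length (ho.symm.trans h)
    simp [SetNeuron] at hl
    omega
  | cons i tl ih =>
    intro a₁ a₂ l₁ l₂ h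
    have hf := aux_feature N tl len
    have hc := (AfterNstepsNeuron N tl len).CurPot_Output
    simp only [AfterNstepsNeuron, NextNeuron] at h
    generalize AfterNstepsNeuron N tl len = M at *
    cases l₁ with
    | cons b l =>
      simp only [List.cons_append, List.cons.injEq] at h
      exact ih a₁ a₂ l l₂ h.2
    | nil =>
      simp only [List.nil_append, List.cons_append, List.cons.injEq] at h
      obtain ⟨h1, h2⟩ := h
      rw [h2] at hc
      simp only [List.headD_cons] at hc
      cases a₂ with
      | false => right; rfl
      | true =>
        left
        have hc' := of_decide_eq_true hc
        rw [← h1, NextPotential, if_pos hc', hf, aux_potential_s6 _ _ id _ hone.2]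
        have := N.Feature.PosTau
        apply decide_eq_false
        split_ifs <;> linarith

theorem Filtering_Effect (N : Neuron) (id : ℕ) (inp : List Bool) (len : ℕ)
    (hone : One_Input_Or_Less N.Feature id len)
    (hinit : is_initial_neuro N len)
    (hw : N.Feature.Weights id < N.Feature.Tau) :
    ∀ (a₁ a₂ : Bool) (l₁ l₂ : List Bool),
      (AfterNstepsNeuron N (inpSI inp) len).Output = l₁ ++ [a₁, a₂] ++ l₂ →
      a₁ = false ∨ a₂ = false := by 
  exact aux_chain N id (inpSI inp) len hone hinit hw
end

section
/- For every neuronal circuit NC, neuron N, and input list inp : List (ℕ → Bool), if is_initial_Cir(NC), N is a member of ListNeuro(NC), and w_N(id) ≥ 0 for every id < len(NC), then curpot_NC(N, inp) ≥ 0. -/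
theorem potential_nonneg_aux (w : ℕ → ℚ) (inp : ℕ → Bool) (len : ℕ)
    (hw : ∀ id, id < len → 0 ≤ w id) : 0 ≤ potential w inp len := by
  induction len with
  | zero => simp [potential]
  | succ m ih =>
    have h1 := ih (fun id h => hw id (by omega))
    have h2 := hw m (by omega)
    unfold potential
    split_ifs <;> linarith

theorem lenNC_Nsteps_aux (NC : NeuroCircuit) (inp : List (ℕ → Bool)) :
    lenNC (Nstepscircuit NC inp) = lenNC NC := by
  induction inp with
  | nil => rfl
  | cons h tl ih =>
    rw [← ih]
    simp [Nstepscircuit, lenNC, NextStepC, NextListNeuro]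

theorem inv_aux (NC : NeuroCircuit) (N : Neuron) (inp : List (ℕ → Bool))
    (hinit : is_initial_Cir NC)
    (hmem : N ∈ NC.ListNeuro)
    (hw : ∀ id, id < lenNC NC → 0 ≤ N.Feature.Weights id) :
    ∀ n ∈ (Nstepscircuit NC inp).ListNeuro, n.Feature.Id = N.Feature.Id →
      n.Feature = N.Feature ∧ 0 ≤ n.CurPot := by
  induction inp with
  | nil =>
    intro n hn hid
    have hn' : n ∈ NC.ListNeuro := hn
    have heq : n = N := by
      by_contra hne
      haveI : Std.Symm (fun a b : Neuron => a.Feature.Id ≠ b.Feature.Id) :=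
        ⟨fun _ _ h => Ne.symm h⟩
      have := NC.IdNeuroDiff.forall hn' hmem hne
      exact this hid
    subst heq
    obtain ⟨nf, _, _, hc⟩ := hinit n hn'
    refine ⟨rfl, ?_⟩
    rw [hc]
    exact le_refl (0 : ℚ)
  | cons h tl ih =>
    intro n hn hid
    have hn' : n ∈ (Nstepscircuit NC tl).ListNeuro.map
      (NextNeuroInNC (Nstepscircuit NC tl) h) := hn
    rw [List.mem_map] at hn'
    obtain ⟨m, hm, rfl⟩ := hn'
    obtain ⟨hf, hp⟩ := ih m hm hid
    refine ⟨hf, ?_⟩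
    simp only [NextNeuroInNC, NextNeuron, NextPotential, lenNC_Nsteps_aux]
    have h1 := fun i => potential_nonneg_aux m.Feature.Weights i (lenNC NC) (by rw [hf]; exact hw)
    have h2 := mul_nonneg m.Feature.LeakRange.1 hp
    split_ifs
    · exact h1 _
    · exact add_nonneg (h1 _) h2

theorem AlwaysNNegNC (NC : NeuroCircuit) (N : Neuron) (inp : List (ℕ → Bool))
    (hinit : is_initial_Cir NC)
    (hmem : N ∈ NC.ListNeuro)
    (hw : ∀ id, id < lenNC NC → 0 ≤ N.Feature.Weights id) :
    0 ≤ curpot_neuron NC inp N.Feature.Id := by 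
  unfold curpot_neuron
  split
  · rename_i x hx
    have hid : x.Feature.Id = N.Feature.Id := by simpa using List.find?_some hx
    exact (inv_aux NC N inp hinit hmem hw x (List.mem_of_find?_eq_some hx) hid).2
  · exact le_refl _
end

section
/- (Delayer effect in a simple series.) For every neuronal circuit NC, neuron N, and input sequence inp : List Bool, if Series(NC), N is a member of ListNeuro(NC), is_initial_Cir(NC), w_{N_0}(length(ListNeuro(NC))) ≥ τ_{N_0}, and for every i with i + 1 < length(ListNeuro(NC)) we have w_{N_{i+1}}(i) ≥ τ_{N_{i+1}}, then: output_NC(N, inp) = drop(id_N, inp) ++ repeat(false, id_N + 1) if id_N ≤ length(inp), and output_NC(N, inp) = repeat(false, length(inp) + 1) otherwise. -/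
def Series (c : NeuroCircuit) : Prop :=
  c.SupplInput = 1 ∧ 0 < c.ListNeuro.length ∧
  (∀ n ∈ c.ListNeuro, n.Feature.Id = 0 →
    (∀ id' < c.ListNeuro.length, n.Feature.Weights id' = 0) ∧
    0 < n.Feature.Weights c.ListNeuro.length) ∧
  (∀ n ∈ c.ListNeuro, ∀ m, n.Feature.Id = m + 1 →
    (∀ id', m ≠ id' → id' < c.ListNeuro.length + 1 → n.Feature.Weights id' = 0) ∧
    0 < n.Feature.Weights m)

def gspec (k : ℕ) (t : List Bool) : List Bool :=
  t.drop k ++ List.replicate (min k t.length + 1) false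

lemma gspec_zero (b : Bool) (t : List Bool) : gspec 0 (b :: t) = b :: gspec 0 t := by
  simp [gspec]

lemma gspec_succ (k : ℕ) (b : Bool) (t : List Bool) :
    gspec (k + 1) (b :: t) = (gspec k t).headD false :: gspec (k + 1) t := by
  unfold gspec
  rcases lt_or_ge k t.length with h | h
  · rw [List.drop_eq_getElem_cons h]
    have h1 : min (k + 1) (b :: t).length = k + 1 := by simp; omega
    have h2 : min (k + 1) t.length = k + 1 := by omega
    rw [h1, h2, List.drop_succ_cons, List.drop_eq_getElem_cons h]
    rfl
  · have h1 : min (k + 1) (b :: t).length = t.length + 1 := by simp; omega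
    have h2 : min (k + 1) t.length = t.length := by omega
    have h3 : t.drop (k + 1) = [] := List.drop_eq_nil_of_le (by omega)
    have h4 : t.drop k = [] := List.drop_eq_nil_of_le (by omega)
    rw [h1, h2]
    simp [h3, h4, List.replicate_succ]

lemma potential_zero (w : ℕ → ℚ) (f : ℕ → Bool) (L : ℕ) (h : ∀ x < L, w x = 0) :
    potential w f L = 0 := by
  induction L with
  | zero => rfl
  | succ m ih =>
    simp [potential, ih (fun x hx => h x (by omega)), h m (by omega)]

lemma potential_one (w : ℕ → ℚ) (f : ℕ → Bool) (k L : ℕ) (hk : k < L)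
    (h : ∀ x < L, x ≠ k → w x = 0) :
    potential w f L = if f k then w k else 0 := by
  induction L with
  | zero => omega
  | succ m ih =>
    by_cases hm : k = m
    · subst hm
      simp [potential, potential_zero w f k (fun x hx => h x (by omega) (by omega))]
    · simp [potential, ih (by omega) (fun x hx => h x (by omega)), h m (by omega) (Ne.symm hm)]

lemma exists_id (C : NeuroCircuit) (x : ℕ) (hx : x < C.ListNeuro.length) :
    ∃ n ∈ C.ListNeuro, n.Feature.Id = x := by
  have hnd : (C.ListNeuro.map (fun n => n.Feature.Id)).Nodup := by
    rw [List.Nodup, List.pairwise_map]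
    exact C.IdNeuroDiff
  have hsub : (C.ListNeuro.map (fun n => n.Feature.Id)).toFinset ⊆
      Finset.range C.ListNeuro.length := by
    intro y hy
    simp only [List.mem_toFinset, List.mem_map] at hy
    obtain ⟨n, hn, rfl⟩ := hy
    exact Finset.mem_range.2 (C.IdInfLen n hn)
  have heq := Finset.eq_of_subset_of_card_le hsub (by
    rw [List.toFinset_card_of_nodup hnd]; simp)
  have : x ∈ Finset.range C.ListNeuro.length := Finset.mem_range.2 hx
  rw [← heq] at this
  simpa using this

lemma output_init_eq (C : NeuroCircuit) (x : ℕ) (o : List Bool)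
    (hx : x < C.ListNeuro.length)
    (h : ∀ n ∈ C.ListNeuro, n.Feature.Id = x → n.Output = o) :
    output_neuron_init C x = o := by
  obtain ⟨n, hn, hid⟩ := exists_id C x hx
  unfold output_neuron_init
  split
  · rename_i y hy
    exact h y (List.mem_of_find?_eq_some hy) (by simpa using List.find?_some hy)
  · rename_i hy
    have := List.find?_eq_none.1 hy n hn
    simp [hid] at this

def srcOf (L : ℕ) : ℕ → ℕ
  | 0 => L
  | m + 1 => m

def SInv (L : ℕ) (C : NeuroCircuit) (t : List Bool) : Prop :=
  C.ListNeuro.length = L ∧ C.SupplInput = 1 ∧ ∀ n ∈ C.ListNeuro,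
    (∀ x < L + 1, x ≠ srcOf L n.Feature.Id → n.Feature.Weights x = 0) ∧
    n.Feature.Tau ≤ n.Feature.Weights (srcOf L n.Feature.Id) ∧
    (¬ n.Feature.Tau ≤ n.CurPot → n.CurPot = 0) ∧
    n.Output = gspec n.Feature.Id t

lemma SInv_step (L : ℕ) (C : NeuroCircuit) (t : List Bool) (b : Bool) (h : SInv L C t) :
    SInv L (NextStepC C (fun _ => b)) (b :: t) := by
  obtain ⟨hL, hS, hN⟩ := h
  refine ⟨by simpa [NextStepC, NextListNeuro] using hL, hS, ?_⟩
  intro n' hn'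
  simp only [NextStepC, NextListNeuro, List.mem_map] at hn'
  obtain ⟨n, hn, rfl⟩ := hn'
  obtain ⟨h1, h2, h3, h4⟩ := hN n hn
  have hlt := C.IdInfLen n hn
  have hpos := n.Feature.PosTau
  have hsrc : srcOf L n.Feature.Id < L + 1 := by
    cases hid : n.Feature.Id <;> simp only [srcOf] <;> omega
  have hnp : ∀ f : ℕ → Bool, NextPotential n f (lenNC C) =
      if f (srcOf L n.Feature.Id) then n.Feature.Weights (srcOf L n.Feature.Id) else 0 := by
    intro f
    have hp := potential_one n.Feature.Weights f _ (L + 1) hsrc h1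
    unfold NextPotential lenNC
    rw [hL, hS, hp]
    by_cases hc : n.Feature.Tau ≤ n.CurPot
    · simp [hc]
    · simp [h3 hc]
  refine ⟨h1, h2, ?_, ?_⟩
  · simp only [NextNeuroInNC, NextNeuron]
    rw [hnp]
    generalize (if srcOf L n.Feature.Id < C.ListNeuro.length then
      (output_neuron_init C (srcOf L n.Feature.Id)).headD false else b) = c
    cases c
    · simp
    · intro hc; exact absurd h2 (by simpa using hc)
  · simp only [NextNeuroInNC, NextNeuron]
    rw [hnp, h4]
    have key : ∀ c : Bool, decide (n.Feature.Tau ≤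
        if c = true then n.Feature.Weights (srcOf L n.Feature.Id) else 0) = c := by
      intro c
      cases c
      · simpa using hpos
      · simpa using h2
    rw [key]
    cases hid : n.Feature.Id with
    | zero => simp [srcOf, hL, gspec_zero]
    | succ m =>
      rw [gspec_succ]
      have hm : m < C.ListNeuro.length := by omega
      simp only [srcOf, hm, if_true]
      rw [output_init_eq C m (gspec m t) hm]
      intro k hk hkid
      rw [(hN k hk).2.2.2, hkid]

theorem Series_Delayer_Effect (NC : NeuroCircuit) (N : Neuron) (inp : List Bool)
    (hser : Series NC)
    (hmem : N ∈ NC.ListNeuro)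
    (hinit : is_initial_Cir NC)
    (hw0 : ∀ n ∈ NC.ListNeuro, n.Feature.Id = 0 →
      n.Feature.Tau ≤ n.Feature.Weights NC.ListNeuro.length)
    (hwS : ∀ i, i + 1 < NC.ListNeuro.length →
      ∀ n ∈ NC.ListNeuro, n.Feature.Id = i + 1 →
        n.Feature.Tau ≤ n.Feature.Weights i) :
    (N.Feature.Id ≤ inp.length →
      output_neuron NC (inpSI inp) N.Feature.Id =
        inp.drop N.Feature.Id ++ List.replicate (N.Feature.Id + 1) false) ∧
    (inp.length < N.Feature.Id →
      output_neuron NC (inpSI inp) N.Feature.Id =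
        List.replicate (inp.length + 1) false) := by
  obtain ⟨hs1, hs2, hs3, hs4⟩ := hser
  have h0 : SInv NC.ListNeuro.length NC [] := by
    refine ⟨rfl, hs1, ?_⟩
    intro n hn
    obtain ⟨nf, _, ho, hp⟩ := hinit n hn
    have hlt := NC.IdInfLen n hn
    have hout : n.Output = gspec n.Feature.Id [] := by
      rw [ho]; simp [SetNeuron, gspec]
    cases hid : n.Feature.Id with
    | zero =>
      refine ⟨fun x hx hne => (hs3 n hn hid).1 x ?_, hw0 n hn hid, fun _ => hp, hid ▸ hout⟩
      simp only [srcOf] at hne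
      omega
    | succ m =>
      exact ⟨fun x hx hne => (hs4 n hn m hid).1 x (Ne.symm hne) hx,
        hwS m (by omega) n hn hid, fun _ => hp, hid ▸ hout⟩
  have hall : ∀ t : List Bool, SInv NC.ListNeuro.length (Nstepscircuit NC (inpSI t)) t := by
    intro t
    induction t with
    | nil => exact h0
    | cons b t ih => exact SInv_step _ _ t b ih
  obtain ⟨hL, _, hN⟩ := hall inp
  have hout : output_neuron NC (inpSI inp) N.Feature.Id = gspec N.Feature.Id inp :=
    output_init_eq (Nstepscircuit NC (inpSI inp)) N.Feature.Id _
      (hL ▸ NC.IdInfLen N hmem) (fun n hn hid => hid ▸ (hN n hn).2.2.2)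
  rw [hout]
  constructor
  · intro h
    simp [gspec, min_eq_left h]
  · intro h
    simp [gspec, min_eq_right h.le, List.drop_eq_nil_of_le h.le]
end

section
/- (Delayer effect in parallel composition.) For every neuronal circuit NC and input sequence inp : List Bool, if ParallelComposition(NC), is_initial_Cir(NC), w_{N_0}(length(ListNeuro(NC))) ≥ τ_{N_0}, and every neuron N of ListNeuro(NC) with id_N ≠ 0 satisfies w_N(0) ≥ τ_N, then: output_NC(N_0, inp) = inp ++ [false]; and for every neuron N of ListNeuro(NC) with id_N ≠ 0, output_NC(N, inp) = drop(1, inp) ++ [false; false] if 0 < length(inp), and output_NC(N, inp) = [false] otherwise. -/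
def ParallelComposition (c : NeuroCircuit) : Prop :=
  c.SupplInput = 1 ∧ 0 < c.ListNeuro.length ∧
  (∀ n ∈ c.ListNeuro, n.Feature.Id = 0 →
    (∀ id' < c.ListNeuro.length, n.Feature.Weights id' = 0) ∧
    0 < n.Feature.Weights c.ListNeuro.length) ∧
  (∀ n ∈ c.ListNeuro, ∀ m, n.Feature.Id = m + 1 →
    (∀ id', (0 : ℕ) ≠ id' → id' < c.ListNeuro.length + 1 → n.Feature.Weights id' = 0) ∧
    0 < n.Feature.Weights 0)

theorem aux_pot0 (w : ℕ → ℚ) (inp : ℕ → Bool) : ∀ len : ℕ,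
    (∀ i < len, w i = 0) → potential w inp len = 0
  | 0, _ => rfl
  | m + 1, h => by
    have := aux_pot0 w inp m (fun i hi => h i (by omega))
    simp [potential, this, h m (by omega)]

theorem aux_pot (w : ℕ → ℚ) (inp : ℕ → Bool) (k : ℕ) : ∀ len : ℕ, k < len →
    (∀ i < len, i ≠ k → w i = 0) → potential w inp len = if inp k then w k else 0
  | 0, hk, _ => by omega
  | m + 1, hk, h => by
    by_cases e : k = m
    · subst e
      have := aux_pot0 w inp k (fun i hi => h i (by omega) (by omega))
      simp [potential, this]
    · have := aux_pot w inp k m (by omega) (fun i hi => h i (by omega))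
      simp [potential, this, h m (by omega) (Ne.symm e)]

def AuxGood (n : Neuron) (k len : ℕ) : Prop :=
  k < len ∧ (∀ i < len, i ≠ k → n.Feature.Weights i = 0) ∧
    n.Feature.Tau ≤ n.Feature.Weights k ∧ (n.CurPot < n.Feature.Tau → n.CurPot = 0)

theorem aux_next (n : Neuron) (k len : ℕ) (inp : ℕ → Bool) (h : AuxGood n k len) :
    AuxGood (NextNeuron inp len n) k len ∧
      (NextNeuron inp len n).Output = inp k :: n.Output := by
  obtain ⟨hk, hw, ht, hc⟩ := h
  have hp := aux_pot n.Feature.Weights inp k len hk hw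
  have hτ := n.Feature.PosTau
  have hN : NextPotential n inp len = if inp k then n.Feature.Weights k else 0 := by
    unfold NextPotential
    rw [hp]
    split_ifs with h1 <;> first | rfl | simp [hc (not_le.mp h1)]
  refine ⟨⟨hk, hw, ht, ?_⟩, ?_⟩
  · simp only [NextNeuron, hN]
    intro h
    split_ifs at h ⊢
    · linarith
    · rfl
  · simp only [NextNeuron, hN]
    cases hb : inp k <;> simp [ht, hτ]

theorem aux_exists (nc : NeuroCircuit) (h : 0 < nc.ListNeuro.length) :
    ∃ n ∈ nc.ListNeuro, n.Feature.Id = 0 := by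
  have hnd : (nc.ListNeuro.map (fun n => n.Feature.Id)).Nodup :=
    List.pairwise_map.mpr nc.IdNeuroDiff
  have hsub : (nc.ListNeuro.map (fun n => n.Feature.Id)).toFinset ⊆
      Finset.range nc.ListNeuro.length := by
    intro x hx
    simp only [List.mem_toFinset, List.mem_map] at hx
    obtain ⟨n, hn, rfl⟩ := hx
    exact Finset.mem_range.mpr (nc.IdInfLen n hn)
  have heq := Finset.eq_of_subset_of_card_le hsub
    (by rw [List.toFinset_card_of_nodup hnd]; simp)
  have : 0 ∈ (nc.ListNeuro.map (fun n => n.Feature.Id)).toFinset := by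
    rw [heq]; exact Finset.mem_range.mpr h
  simpa using this

theorem aux_find (nc : NeuroCircuit) (id : ℕ) (X : List Bool)
    (he : ∃ n ∈ nc.ListNeuro, n.Feature.Id = id)
    (hX : ∀ n ∈ nc.ListNeuro, n.Feature.Id = id → n.Output = X) :
    output_neuron_init nc id = X := by
  unfold output_neuron_init
  split
  · rename_i x hx
    exact hX x (List.mem_of_find?_eq_some hx) (by simpa using List.find?_some hx)
  · rename_i hx
    obtain ⟨n, hn, hid⟩ := he
    have := List.find?_eq_none.mp hx n hn
    simp [hid] at this

def auxExp (id : ℕ) (L : List Bool) : List Bool :=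
  if id = 0 then L ++ [false] else (L ++ [false]).tail ++ [false]

def AuxInv (nc : NeuroCircuit) (len : ℕ) (L : List Bool) : Prop :=
  nc.SupplInput = 1 ∧ nc.ListNeuro.length = len ∧
  ∀ n ∈ nc.ListNeuro, AuxGood n (if n.Feature.Id = 0 then len else 0) (len + 1) ∧
    n.Output = auxExp n.Feature.Id L

theorem aux_step (nc : NeuroCircuit) (len : ℕ) (hl : 0 < len) (L : List Bool) (b : Bool)
    (h : AuxInv nc len L) : AuxInv (NextStepC nc (fun _ => b)) len (b :: L) := by
  obtain ⟨hs, hlen, hn⟩ := h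
  have h0 : output_neuron_init nc 0 = L ++ [false] := by
    apply aux_find nc 0 _ (aux_exists nc (by omega))
    intro n hm hid
    rw [(hn n hm).2, hid]; rfl
  refine ⟨hs, by simp [NextStepC, NextListNeuro, hlen], ?_⟩
  intro n' hn'
  simp only [NextStepC, NextListNeuro, List.mem_map] at hn'
  obtain ⟨n, hm, rfl⟩ := hn'
  obtain ⟨hg, ho⟩ := hn n hm
  have hL : lenNC nc = len + 1 := by simp [lenNC, hs, hlen]
  have hid : (NextNeuroInNC nc (fun _ => b) n).Feature.Id = n.Feature.Id := rfl
  rw [hid]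
  unfold NextNeuroInNC
  rw [hL]
  obtain ⟨g, o⟩ := aux_next n _ (len + 1)
    (fun x => if x < nc.ListNeuro.length then (output_neuron_init nc x).headD false else b) hg
  refine ⟨g, ?_⟩
  rw [o, ho]
  by_cases e : n.Feature.Id = 0
  · simp [e, auxExp, hlen]
  · simp only [e, auxExp, hlen, h0, hl, if_true, if_false]
    cases L <;> simp

theorem aux_all (nc : NeuroCircuit) (len : ℕ) (hl : 0 < len) (h : AuxInv nc len []) :
    ∀ L : List Bool, AuxInv (Nstepscircuit nc (inpSI L)) len L
  | [] => h
  | b :: L => aux_step _ len hl L b (aux_all nc len hl h L)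

theorem aux_mem (nc : NeuroCircuit) (id : ℕ) (h : ∃ n ∈ nc.ListNeuro, n.Feature.Id = id) :
    ∀ L : List (ℕ → Bool), ∃ n ∈ (Nstepscircuit nc L).ListNeuro, n.Feature.Id = id
  | [] => h
  | b :: L => by
    obtain ⟨n, hn, hid⟩ := aux_mem nc id h L
    exact ⟨_, List.mem_map_of_mem hn, hid⟩

theorem ParalComp_Delayer_Effect (NC : NeuroCircuit) (inp : List Bool)
    (hpar : ParallelComposition NC)
    (hinit : is_initial_Cir NC)
    (hw0 : ∀ n ∈ NC.ListNeuro, n.Feature.Id = 0 →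
      n.Feature.Tau ≤ n.Feature.Weights NC.ListNeuro.length)
    (hwS : ∀ n ∈ NC.ListNeuro, n.Feature.Id ≠ 0 →
      n.Feature.Tau ≤ n.Feature.Weights 0) :
    output_neuron NC (inpSI inp) 0 = inp ++ [false] ∧
    (∀ n ∈ NC.ListNeuro, n.Feature.Id ≠ 0 →
      (0 < inp.length →
        output_neuron NC (inpSI inp) n.Feature.Id =
          inp.drop 1 ++ [false, false]) ∧
      (inp.length = 0 →
        output_neuron NC (inpSI inp) n.Feature.Id = [false])) := by
  obtain ⟨hs, hl, hz, hS⟩ := hpar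
  have hI : AuxInv NC NC.ListNeuro.length [] := by
    refine ⟨hs, rfl, fun n hn => ?_⟩
    obtain ⟨nf, -, ho, hc⟩ := hinit n hn
    have ho' : n.Output = [false] := ho
    have hc' : n.CurPot = 0 := hc
    by_cases e : n.Feature.Id = 0
    · simp only [e, if_true]
      exact ⟨⟨by omega, fun i hi hne => (hz n hn e).1 i (by omega), hw0 n hn e,
        fun _ => hc'⟩, by simp [auxExp, ho']⟩
    · simp only [e, if_false]
      obtain ⟨m, hm⟩ := Nat.exists_eq_succ_of_ne_zero e
      exact ⟨⟨by omega, fun i hi hne => (hS n hn m hm).1 i (Ne.symm hne) hi, hwS n hn e,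
        fun _ => hc'⟩, by simp [auxExp, ho', e]⟩
  have hA := aux_all NC _ hl hI inp
  have key : ∀ id, (∃ n ∈ NC.ListNeuro, n.Feature.Id = id) →
      output_neuron NC (inpSI inp) id = auxExp id inp := by
    intro id he
    refine aux_find (Nstepscircuit NC (inpSI inp)) id _ (aux_mem NC id he _) ?_
    intro n hn hid
    rw [(hA.2.2 n hn).2, hid]
  refine ⟨key 0 (aux_exists NC hl), fun n hn hid => ?_⟩
  rw [key _ ⟨n, hn, rfl⟩]
  cases inp <;> simp [auxExp, hid]
end

section
/- (Amplifier property of the positive loop.) For every neuronal circuit NC and input sequences inp₁, inp₂ : List Bool, if PositiveLoop(NC), is_initial_Cir(NC), every element of inp₂ equals false, w_{N_0}(2) ≥ τ_{N_0}, w_{N_0}(1) ≥ τ_{N_0}, and w_{N_1}(0) ≥ τ_{N_1}, then output_NC(N_0, inp₁ ++ [true; true] ++ inp₂) = repeat(true, length(inp₁) + 2) ++ repeat(false, length(inp₂) + 1), and output_NC(N_1, inp₁ ++ [true; true] ++ inp₂) = repeat(true, length(inp₁) + 1) ++ repeat(false, length(inp₂) + 2). -/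
def PositiveLoop (c : NeuroCircuit) : Prop :=
  c.SupplInput = 1 ∧ c.ListNeuro.length = 2 ∧
  (∀ n ∈ c.ListNeuro, n.Feature.Id = 0 →
    0 < n.Feature.Weights 1 ∧ 0 < n.Feature.Weights 2) ∧
  (∀ n ∈ c.ListNeuro, n.Feature.Id = 1 →
    0 < n.Feature.Weights 0 ∧ n.Feature.Weights 2 = 0)

def PLInv (f0 f1 : NeuronFeature) (nc : NeuroCircuit) (o0 o1 : List Bool) (p0 p1 : ℚ) : Prop :=
  ∃ n0 n1 : Neuron, (nc.ListNeuro = [n0, n1] ∨ nc.ListNeuro = [n1, n0]) ∧ nc.SupplInput = 1 ∧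
    n0.Feature = f0 ∧ n1.Feature = f1 ∧ n0.Output = o0 ∧ n1.Output = o1 ∧
    n0.CurPot = p0 ∧ n1.CurPot = p1

def PLq0 (f0 : NeuronFeature) (b b1 : Bool) (p0 : ℚ) : ℚ :=
  (if b1 then f0.Weights 1 else 0) + (if b then f0.Weights 2 else 0) +
    (if f0.Tau ≤ p0 then 0 else f0.Leak_Factor * p0)

def PLq1 (f1 : NeuronFeature) (b0 : Bool) (p1 : ℚ) : ℚ :=
  (if b0 then f1.Weights 0 else 0) + (if f1.Tau ≤ p1 then 0 else f1.Leak_Factor * p1)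

theorem PL_next0 (n : Neuron) (i : ℕ → Bool) (h : n.Feature.Id = 0) :
    NextPotential n i 3 = PLq0 n.Feature (i 2) (i 1) n.CurPot := by
  have h0 : n.Feature.Weights 0 = 0 := by
    have := n.Feature.WId
    rwa [h] at this
  unfold NextPotential PLq0
  simp only [potential, h0]
  split_ifs <;> ring

theorem PL_next1 (n : Neuron) (i : ℕ → Bool) (h : n.Feature.Id = 1)
    (h2 : n.Feature.Weights 2 = 0) :
    NextPotential n i 3 = PLq1 n.Feature (i 0) n.CurPot := by
  have h0 : n.Feature.Weights 1 = 0 := by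
    have := n.Feature.WId
    rwa [h] at this
  unfold NextPotential PLq1
  simp only [potential, h0, h2]
  split_ifs <;> ring

theorem PLInv_out (f0 f1 : NeuronFeature) (nc : NeuroCircuit) (o0 o1 : List Bool) (p0 p1 : ℚ)
    (h0 : f0.Id = 0) (h1 : f1.Id = 1) (h : PLInv f0 f1 nc o0 o1 p0 p1) :
    output_neuron_init nc 0 = o0 ∧ output_neuron_init nc 1 = o1 := by
  obtain ⟨n0, n1, hl, -, rfl, rfl, rfl, rfl, -, -⟩ := h
  unfold output_neuron_init
  rcases hl with hl | hl <;> simp [hl, List.find?, h0, h1]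

theorem PLInv_step (f0 f1 : NeuronFeature) (nc : NeuroCircuit) (o0 o1 : List Bool) (p0 p1 : ℚ)
    (h0 : f0.Id = 0) (h1 : f1.Id = 1) (h2 : f1.Weights 2 = 0) (b : Bool)
    (h : PLInv f0 f1 nc o0 o1 p0 p1) :
    PLInv f0 f1 (NextStepC nc (fun _ => b))
      (decide (f0.Tau ≤ PLq0 f0 b (o1.headD false) p0) :: o0)
      (decide (f1.Tau ≤ PLq1 f1 (o0.headD false) p1) :: o1)
      (PLq0 f0 b (o1.headD false) p0) (PLq1 f1 (o0.headD false) p1) := by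
  obtain ⟨e0, e1⟩ := PLInv_out f0 f1 nc o0 o1 p0 p1 h0 h1 h
  obtain ⟨n0, n1, hl, hs, rfl, rfl, rfl, rfl, rfl, rfl⟩ := h
  have hlen : nc.ListNeuro.length = 2 := by rcases hl with hl | hl <;> simp [hl]
  have hlen3 : lenNC nc = 3 := by simp [lenNC, hlen, hs]
  refine ⟨NextNeuroInNC nc (fun _ => b) n0, NextNeuroInNC nc (fun _ => b) n1, ?_, hs, rfl, rfl,
    ?_, ?_, ?_, ?_⟩
  · rcases hl with hl | hl <;> simp [NextStepC, NextListNeuro, hl]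
  all_goals
    simp only [NextNeuroInNC, NextNeuron, hlen3, PL_next0 _ _ h0, PL_next1 _ _ h1 h2, hlen, e0, e1]
    simp

theorem PL_zero (f0 f1 : NeuronFeature) (nc : NeuroCircuit)
    (h0 : f0.Id = 0) (h1 : f1.Id = 1) (h2 : f1.Weights 2 = 0)
    (h : PLInv f0 f1 nc [false] [false] 0 0) (l : List Bool) (hz : ∀ b ∈ l, b = false) :
    PLInv f0 f1 (Nstepscircuit nc (inpSI l)) (List.replicate (l.length + 1) false)
      (List.replicate (l.length + 1) false) 0 0 := by
  induction l with
  | nil => exact h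
  | cons a l ih =>
    have ha : a = false := hz a (by simp)
    subst ha
    have := PLInv_step _ _ _ _ _ _ _ h0 h1 h2 false (ih (fun b hb => hz b (by simp [hb])))
    have t0 := not_le.mpr f0.PosTau
    have t1 := not_le.mpr f1.PosTau
    simpa [PLq0, PLq1, List.replicate_succ, t0, t1, inpSI, Nstepscircuit] using this

theorem PL_main (f0 f1 : NeuronFeature) (nc : NeuroCircuit)
    (h0 : f0.Id = 0) (h1 : f1.Id = 1) (h2 : f1.Weights 2 = 0)
    (a2 : f0.Tau ≤ f0.Weights 2) (a1 : f0.Tau ≤ f0.Weights 1) (a0 : f1.Tau ≤ f1.Weights 0)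
    (h : PLInv f0 f1 nc [false] [false] 0 0) (l l2 : List Bool) (hz : ∀ b ∈ l2, b = false) :
    ∃ p0 p1, f0.Tau ≤ p0 ∧ f1.Tau ≤ p1 ∧
    PLInv f0 f1 (Nstepscircuit nc (inpSI (l ++ [true, true] ++ l2)))
      (List.replicate (l.length + 2) true ++ List.replicate (l2.length + 1) false)
      (List.replicate (l.length + 1) true ++ List.replicate (l2.length + 2) false) p0 p1 := by
  have t0 := not_le.mpr f0.PosTau
  have t1 := not_le.mpr f1.PosTau
  induction l with
  | nil =>
    have s0 := PL_zero f0 f1 nc h0 h1 h2 h l2 hz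
    have s1 := PLInv_step _ _ _ _ _ _ _ h0 h1 h2 true s0
    have s2 := PLInv_step _ _ _ _ _ _ _ h0 h1 h2 true s1
    refine ⟨f0.Weights 2, f1.Weights 0, a2, a0, ?_⟩
    simpa [PLq0, PLq1, List.replicate_succ, t0, t1, a0, a1, a2, inpSI, Nstepscircuit] using s2
  | cons a l ih =>
    obtain ⟨p0, p1, g0, g1, s⟩ := ih
    have s1 := PLInv_step _ _ _ _ _ _ _ h0 h1 h2 a s
    have e0 : f0.Tau ≤ PLq0 f0 a true p0 := by
      have := f0.PosTau
      unfold PLq0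
      simp only [g0, if_true]
      split_ifs <;> linarith
    have e1 : f1.Tau ≤ PLq1 f1 true p1 := by
      simp [PLq1, g1, a0]
    refine ⟨_, _, e0, e1, ?_⟩
    simpa [List.replicate_succ, e0, e1, inpSI, Nstepscircuit] using s1

theorem PL_init (NC : NeuroCircuit) (hpl : PositiveLoop NC) (hinit : is_initial_Cir NC) :
    ∃ n0 ∈ NC.ListNeuro, ∃ n1 ∈ NC.ListNeuro, n0.Feature.Id = 0 ∧ n1.Feature.Id = 1 ∧
      PLInv n0.Feature n1.Feature NC [false] [false] 0 0 := by
  obtain ⟨hs, hlen, -, -⟩ := hpl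
  have hd := NC.IdNeuroDiff
  have hi := NC.IdInfLen
  rw [hlen] at hi
  have key : ∀ n ∈ NC.ListNeuro, n.Output = [false] ∧ n.CurPot = 0 := by
    intro n hn
    obtain ⟨nf, -, ho, hp⟩ := hinit n hn
    exact ⟨ho, hp⟩
  obtain ⟨a, b, hab⟩ := List.length_eq_two.mp hlen
  have ma : a ∈ NC.ListNeuro := by simp [hab]
  have mb : b ∈ NC.ListNeuro := by simp [hab]
  have ia := hi a ma
  have ib := hi b mb
  rw [hab] at hd
  have hne : a.Feature.Id ≠ b.Feature.Id := by simpa using hd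
  by_cases h : a.Feature.Id = 0
  · exact ⟨a, ma, b, mb, h, by omega, a, b, Or.inl hab, hs, rfl, rfl, (key a ma).1, (key b mb).1,
      (key a ma).2, (key b mb).2⟩
  · exact ⟨b, mb, a, ma, by omega, by omega, b, a, Or.inr hab, hs, rfl, rfl, (key b mb).1,
      (key a ma).1, (key b mb).2, (key a ma).2⟩

theorem PL_Amplifier_input_2_true (NC : NeuroCircuit) (inp₁ inp₂ : List Bool)
    (hpl : PositiveLoop NC)
    (hinit : is_initial_Cir NC)
    (hw0 : ∀ n ∈ NC.ListNeuro, n.Feature.Id = 0 →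
      n.Feature.Tau ≤ n.Feature.Weights 2 ∧ n.Feature.Tau ≤ n.Feature.Weights 1)
    (hw1 : ∀ n ∈ NC.ListNeuro, n.Feature.Id = 1 →
      n.Feature.Tau ≤ n.Feature.Weights 0)
    (hz : ∀ b ∈ inp₂, b = false) :
    output_neuron NC (inpSI (inp₁ ++ [true, true] ++ inp₂)) 0 =
      List.replicate (inp₁.length + 2) true ++ List.replicate (inp₂.length + 1) false ∧
    output_neuron NC (inpSI (inp₁ ++ [true, true] ++ inp₂)) 1 =
      List.replicate (inp₁.length + 1) true ++ List.replicate (inp₂.length + 2) false := by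
  obtain ⟨n0, m0, n1, m1, h0, h1, hI⟩ := PL_init NC hpl hinit
  obtain ⟨a2, a1⟩ := hw0 n0 m0 h0
  obtain ⟨p0, p1, -, -, h⟩ := PL_main n0.Feature n1.Feature NC h0 h1 (hpl.2.2.2 n1 m1 h1).2 a2 a1
    (hw1 n1 m1 h1) hI inp₁ inp₂ hz
  exact PLInv_out _ _ _ _ _ _ _ h0 h1 h
end

section
/- (Oscillation property of the positive loop.) For every neuronal circuit NC and input sequences inp₁, inp₂ : List Bool, if PositiveLoop(NC), is_initial_Cir(NC), every element of inp₁ ++ inp₂ equals false, w_{N_0}(2) ≥ τ_{N_0}, w_{N_0}(1) ≥ τ_{N_0}, and w_{N_1}(0) ≥ τ_{N_1}, then output_NC(N_0, inp₁ ++ [true] ++ inp₂) = repeat_pattern([true; false], length(inp₁) + 1) ++ repeat(false, length(inp₂) + 1), and output_NC(N_1, inp₁ ++ [true] ++ inp₂) = repeat_pattern([true; false], length(inp₁)) ++ repeat(false, length(inp₂) + 2). -/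
structure PLInv_s16 (nc : NeuroCircuit) (o0 o1 : List Bool) (p q : Bool) : Prop where
  len : nc.ListNeuro.length = 2
  sup : nc.SupplInput = 1
  ex : ∃ a b : Neuron, nc.ListNeuro.find? (fun x => x.Feature.Id == 0) = some a ∧
    nc.ListNeuro.find? (fun x => x.Feature.Id == 1) = some b ∧
    a.Feature.Weights 0 = 0 ∧ b.Feature.Weights 1 = 0 ∧ b.Feature.Weights 2 = 0 ∧
    a.Feature.Tau ≤ a.Feature.Weights 1 ∧ a.Feature.Tau ≤ a.Feature.Weights 2 ∧
    b.Feature.Tau ≤ b.Feature.Weights 0 ∧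
    a.Output = o0 ∧ b.Output = o1 ∧
    (p = true → a.Feature.Tau ≤ a.CurPot) ∧ (p = false → a.CurPot = 0) ∧
    (q = true → b.Feature.Tau ≤ b.CurPot) ∧ (q = false → b.CurPot = 0)

theorem PLInv_s16.step {nc : NeuroCircuit} {o0 o1 : List Bool} {p q : Bool}
    (h : PLInv_s16 nc o0 o1 p q) (x : Bool) :
    PLInv_s16 (NextStepC nc (fun _ => x)) ((q || x) :: o0) (p :: o1) (q || x) p := by
  obtain ⟨hl, hs, a, b, ha, hb, ha0, hb1, hb2, ha1, ha2, hb0, hoa, hob, hp, hp', hq, hq'⟩ := h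
  have ta := a.Feature.PosTau
  have tb := b.Feature.PosTau
  have hda : a.Output.headD false = p := by
    rw [← a.CurPot_Output]
    cases p
    · simp [hp' rfl, ta]
    · simp [hp rfl]
  have hdb : b.Output.headD false = q := by
    rw [← b.CurPot_Output]
    cases q
    · simp [hq' rfl, tb]
    · simp [hq rfl]
  have i0 : (output_neuron_init nc 0).headD false = p := by
    simp only [output_neuron_init, ha, hda]
  have i1 : (output_neuron_init nc 1).headD false = q := by
    simp only [output_neuron_init, hb, hdb]
  rw [List.headD_eq_head?_getD] at i0 i1
  have fd : ∀ (k : ℕ) (c : Neuron), nc.ListNeuro.find? (fun x => x.Feature.Id == k) = some c →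
      (NextStepC nc (fun _ => x)).ListNeuro.find? (fun x => x.Feature.Id == k) =
        some (NextNeuroInNC nc (fun _ => x) c) := by
    intro k c hc
    simp only [NextStepC, NextListNeuro, List.find?_map]
    have : ((fun x : Neuron => x.Feature.Id == k) ∘ NextNeuroInNC nc (fun _ => x)) =
      (fun x : Neuron => x.Feature.Id == k) := rfl
    rw [this, hc]; rfl
  have pa : (NextNeuroInNC nc (fun _ => x) a).CurPot =
      (if x then a.Feature.Weights 2 else 0) + (if q then a.Feature.Weights 1 else 0) := by
    simp only [NextNeuroInNC, NextNeuron, NextPotential, lenNC, hl, hs, potential]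
    norm_num [i0, i1, ha0]
    cases p
    · cases q <;> cases x <;> simp [hp' rfl, add_comm]
    · cases q <;> cases x <;> simp [hp rfl, add_comm]
  have pb : (NextNeuroInNC nc (fun _ => x) b).CurPot =
      (if p then b.Feature.Weights 0 else 0) := by
    simp only [NextNeuroInNC, NextNeuron, NextPotential, lenNC, hl, hs, potential]
    norm_num [i0, i1, hb1, hb2]
    cases q
    · simp [hq' rfl]
    · simp [hq rfl]
  have oa : (NextNeuroInNC nc (fun _ => x) a).Output =
    decide (a.Feature.Tau ≤ (NextNeuroInNC nc (fun _ => x) a).CurPot) :: a.Output := rfl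
  have ob : (NextNeuroInNC nc (fun _ => x) b).Output =
    decide (b.Feature.Tau ≤ (NextNeuroInNC nc (fun _ => x) b).CurPot) :: b.Output := rfl
  have ca : (q || x) = true → a.Feature.Tau ≤ (NextNeuroInNC nc (fun _ => x) a).CurPot := by
    rw [pa]; cases q <;> cases x <;> simp <;> linarith
  have ca' : (q || x) = false → (NextNeuroInNC nc (fun _ => x) a).CurPot = 0 := by
    rw [pa]; cases q <;> cases x <;> simp
  have cb : p = true → b.Feature.Tau ≤ (NextNeuroInNC nc (fun _ => x) b).CurPot := by
    rw [pb]; cases p <;> simp; linarith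
  have cb' : p = false → (NextNeuroInNC nc (fun _ => x) b).CurPot = 0 := by
    rw [pb]; cases p <;> simp
  refine ⟨by simp [NextStepC, NextListNeuro, hl], hs, _, _, fd 0 a ha, fd 1 b hb,
    ha0, hb1, hb2, ha1, ha2, hb0, ?_, ?_, ca, ca', cb, cb'⟩
  · rw [oa, hoa]; congr 1
    cases h : (q || x)
    · simp [ca' h, ta]
    · simp [ca h]
  · rw [ob, hob]; congr 1
    cases h : p
    · simp [cb' h, tb]
    · simp [cb h]

theorem PL_exists_id (NC : NeuroCircuit) (hl : NC.ListNeuro.length = 2) (k : ℕ) (hk : k < 2) :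
    ∃ a ∈ NC.ListNeuro, a.Feature.Id = k ∧
      NC.ListNeuro.find? (fun x => x.Feature.Id == k) = some a := by
  have h1 := NC.IdNeuroDiff
  have h2 := NC.IdInfLen
  obtain ⟨u, v, huv⟩ := List.length_eq_two.mp hl
  rw [huv] at h1 h2 ⊢
  simp at h1 h2
  by_cases hu : u.Feature.Id = k
  · exact ⟨u, by simp, hu, by simp [hu]⟩
  · have hv : v.Feature.Id = k := by omega
    exact ⟨v, by simp, hv, by simp [hu, hv]⟩

theorem PL_rp_succ (n : ℕ) : repeat_pattern [true, false] (n + 1) =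
    decide (n % 2 = 0) :: repeat_pattern [true, false] n := by
  simp only [repeat_pattern, List.range_succ_eq_map]
  simp only [reduceCtorEq, if_false, List.map_cons, List.map_map]
  congr 1
  · rcases Nat.mod_two_eq_zero_or_one n with h | h <;> simp [h]
  · apply List.map_congr_left
    intro i _
    simp only [Function.comp]
    congr 2
    omega

theorem PLInv_s16.out {NC : NeuroCircuit} {l : List (ℕ → Bool)} {o0 o1 : List Bool} {p q : Bool}
    (h : PLInv_s16 (Nstepscircuit NC l) o0 o1 p q) :
    output_neuron NC l 0 = o0 ∧ output_neuron NC l 1 = o1 := by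
  obtain ⟨-, -, a, b, ha, hb, -, -, -, -, -, -, hoa, hob, -⟩ := h
  simp [output_neuron, ha, hb, hoa, hob]

theorem PL_Oscillation_1_true (NC : NeuroCircuit) (inp₁ inp₂ : List Bool)
    (hpl : PositiveLoop NC)
    (hinit : is_initial_Cir NC)
    (hw0 : ∀ n ∈ NC.ListNeuro, n.Feature.Id = 0 →
      n.Feature.Tau ≤ n.Feature.Weights 2 ∧ n.Feature.Tau ≤ n.Feature.Weights 1)
    (hw1 : ∀ n ∈ NC.ListNeuro, n.Feature.Id = 1 →
      n.Feature.Tau ≤ n.Feature.Weights 0)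
    (hz : ∀ b ∈ inp₁ ++ inp₂, b = false) :
    output_neuron NC (inpSI (inp₁ ++ [true] ++ inp₂)) 0 =
      repeat_pattern [true, false] (inp₁.length + 1) ++
        List.replicate (inp₂.length + 1) false ∧
    output_neuron NC (inpSI (inp₁ ++ [true] ++ inp₂)) 1 =
      repeat_pattern [true, false] inp₁.length ++
        List.replicate (inp₂.length + 2) false := by
  obtain ⟨hs, hl, -, hp1⟩ := hpl
  have base : PLInv_s16 NC [false] [false] false false := by
    obtain ⟨a, ham, hai, haf⟩ := PL_exists_id NC hl 0 (by norm_num)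
    obtain ⟨b, hbm, hbi, hbf⟩ := PL_exists_id NC hl 1 (by norm_num)
    obtain ⟨_, -, hao, hac⟩ := hinit a ham
    obtain ⟨_, -, hbo, hbc⟩ := hinit b hbm
    have wa := a.Feature.WId
    have wb := b.Feature.WId
    rw [hai] at wa
    rw [hbi] at wb
    exact ⟨hl, hs, a, b, haf, hbf, wa, wb, (hp1 b hbm hbi).2, (hw0 a ham hai).2,
      (hw0 a ham hai).1, hw1 b hbm hbi, hao, hbo, by simp, fun _ => hac, by simp, fun _ => hbc⟩
  have ph2 : ∀ l : List Bool, (∀ b ∈ l, b = false) →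
      PLInv_s16 (Nstepscircuit NC (inpSI l)) (List.replicate (l.length + 1) false)
        (List.replicate (l.length + 1) false) false false := by
    intro l
    induction l with
    | nil => intro _; exact base
    | cons c l ih =>
      intro h
      have hc : c = false := h c (by simp)
      subst hc
      exact (ih fun b hb => h b (by simp [hb])).step false
  have h2 := ph2 inp₂ fun b hb => hz b (by simp [hb])
  have ph1 : ∀ l : List Bool, (∀ b ∈ l, b = false) →
      PLInv_s16 (Nstepscircuit NC (inpSI (l ++ [true] ++ inp₂)))
        (repeat_pattern [true, false] (l.length + 1) ++ List.replicate (inp₂.length + 1) false)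
        (repeat_pattern [true, false] l.length ++ List.replicate (inp₂.length + 2) false)
        (decide (l.length % 2 = 0)) (decide ((l.length + 1) % 2 = 0)) := by
    intro l
    induction l with
    | nil => intro _; exact h2.step true
    | cons c l ih =>
      intro h
      have hc : c = false := h c (by simp)
      subst hc
      have := (ih fun b hb => h b (by simp [hb])).step false
      rw [Bool.or_false] at this
      rw [List.length_cons, PL_rp_succ (l.length + 1)]
      have e : (l.length + 1 + 1) % 2 = l.length % 2 := by omega
      rw [e]
      rw [PL_rp_succ l.length] at this ⊢
      exact this
  exact (ph1 inp₁ fun b hb => hz b (by simp [hb])).out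
end

section
/- (Negative loop oscillation, opposite-weights case.) For every neuronal circuit NC and input sequence inp : List Bool, if NegativeLoop(NC), is_initial_Cir(NC), every element of inp equals true, w_{N_0}(2) ≥ τ_{N_0}, w_{N_1}(0) ≥ τ_{N_1}, and w_{N_0}(1) = −w_{N_0}(2), then output_NC(N_0, inp) = repeat_pattern([false; true; true; false], length(inp) + 1) and output_NC(N_1, inp) = repeat_pattern([false; false; true; true], length(inp) + 1). -/
def NegativeLoop (c : NeuroCircuit) : Prop :=
  c.SupplInput = 1 ∧ c.ListNeuro.length = 2 ∧
  (∀ n ∈ c.ListNeuro, n.Feature.Id = 0 →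
    n.Feature.Weights 1 < 0 ∧ 0 < n.Feature.Weights 2) ∧
  (∀ n ∈ c.ListNeuro, n.Feature.Id = 1 →
    0 < n.Feature.Weights 0 ∧ n.Feature.Weights 2 = 0)

theorem rp_succ (l : List Bool) (hl : l ≠ []) (n : ℕ) :
    repeat_pattern l (n + 1) = l.getD (n % l.length) false :: repeat_pattern l n := by
  simp only [repeat_pattern, hl, if_false, List.range_succ_eq_map, List.map_cons, List.map_map]
  congr 1
  apply List.map_congr_left
  intro i _
  simp only [Function.comp]
  congr 2
  omega

structure NLInv (nc : NeuroCircuit) (n : ℕ) (a b : Neuron) : Prop where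
  len : nc.ListNeuro.length = 2
  sup : nc.SupplInput = 1
  fa : nc.ListNeuro.find? (fun x => x.Feature.Id == 0) = some a
  fb : nc.ListNeuro.find? (fun x => x.Feature.Id == 1) = some b
  a0 : a.Feature.Weights 0 = 0
  a1 : a.Feature.Weights 1 = -a.Feature.Weights 2
  a2 : a.Feature.Tau ≤ a.Feature.Weights 2
  b0 : b.Feature.Tau ≤ b.Feature.Weights 0
  b1 : b.Feature.Weights 1 = 0
  b2 : b.Feature.Weights 2 = 0
  oa : a.Output = repeat_pattern [false, true, true, false] (n + 1)
  ob : b.Output = repeat_pattern [false, false, true, true] (n + 1)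
  pa : a.CurPot = if [false, true, true, false].getD (n % 4) false then a.Feature.Weights 2 else 0
  pb : b.CurPot = if [false, false, true, true].getD (n % 4) false then b.Feature.Weights 0 else 0

theorem NLInv.step {nc : NeuroCircuit} {n : ℕ} {a b : Neuron} (h : NLInv nc n a b) :
    NLInv (NextStepC nc (fun _ => true)) (n + 1)
      (NextNeuroInNC nc (fun _ => true) a) (NextNeuroInNC nc (fun _ => true) b) := by
  obtain ⟨len, sup, fa, fb, a0, a1, a2, b0, b1, b2, oa, ob, pa, pb⟩ := h
  have ta := a.Feature.PosTau
  have tb := b.Feature.PosTau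
  have ha : (output_neuron_init nc 0).headD false = [false, true, true, false].getD (n % 4) false := by
    simp only [output_neuron_init, fa, oa]
    rw [rp_succ _ (by simp)]; rfl
  have hb : (output_neuron_init nc 1).headD false = [false, false, true, true].getD (n % 4) false := by
    simp only [output_neuron_init, fb, ob]
    rw [rp_succ _ (by simp)]; rfl
  have key : (NextNeuroInNC nc (fun _ => true) a).CurPot =
        (if [false, true, true, false].getD ((n + 1) % 4) false then a.Feature.Weights 2 else 0) ∧
      (NextNeuroInNC nc (fun _ => true) b).CurPot =
        (if [false, false, true, true].getD ((n + 1) % 4) false then b.Feature.Weights 0 else 0) := by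
    have h4 : n % 4 = 0 ∨ n % 4 = 1 ∨ n % 4 = 2 ∨ n % 4 = 3 := by omega
    simp only [NextNeuroInNC, NextNeuron, NextPotential, lenNC, len, sup, potential, pa, pb]
    rcases h4 with h | h | h | h <;>
      simp [Nat.add_mod, h, a0, a1, b1, b2, a2, b0, not_le.mpr ta, not_le.mpr tb]
        at ha hb ⊢ <;> simp [ha, hb]
  obtain ⟨ka, kb⟩ := key
  refine ⟨by simpa [NextStepC, NextListNeuro] using len, sup, ?_, ?_, a0, a1, a2, b0, b1, b2,
    ?_, ?_, ka, kb⟩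
  · simp only [NextStepC, NextListNeuro, List.find?_map]
    exact congrArg (Option.map (NextNeuroInNC nc fun _ => true)) fa
  · simp only [NextStepC, NextListNeuro, List.find?_map]
    exact congrArg (Option.map (NextNeuroInNC nc fun _ => true)) fb
  · rw [rp_succ _ (by simp), ← oa]
    change decide (a.Feature.Tau ≤ (NextNeuroInNC nc (fun _ => true) a).CurPot) :: a.Output = _
    rw [ka]
    congr 1
    change _ = [false, true, true, false].getD ((n + 1) % 4) false
    cases [false, true, true, false].getD ((n + 1) % 4) false <;> simp [a2, ta]
  · rw [rp_succ _ (by simp), ← ob]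
    change decide (b.Feature.Tau ≤ (NextNeuroInNC nc (fun _ => true) b).CurPot) :: b.Output = _
    rw [kb]
    congr 1
    change _ = [false, false, true, true].getD ((n + 1) % 4) false
    cases [false, false, true, true].getD ((n + 1) % 4) false <;> simp [b0, tb]

theorem find_ex (nc : NeuroCircuit) (h : nc.ListNeuro.length = 2) :
    (∃ a, nc.ListNeuro.find? (fun x => x.Feature.Id == 0) = some a) ∧
    (∃ a, nc.ListNeuro.find? (fun x => x.Feature.Id == 1) = some a) := by
  have h1 := nc.IdNeuroDiff
  have h2 := nc.IdInfLen
  obtain ⟨x, y, hxy⟩ := List.length_eq_two.mp h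
  rw [hxy] at h1 h2 ⊢
  simp at h1 h2
  simp only [← Option.isSome_iff_exists, List.find?_isSome]
  simp
  omega

theorem NL_Output_Oscil_case1 (NC : NeuroCircuit) (inp : List Bool)
    (hnl : NegativeLoop NC)
    (hinit : is_initial_Cir NC)
    (ht : ∀ b ∈ inp, b = true)
    (hw02 : ∀ n ∈ NC.ListNeuro, n.Feature.Id = 0 →
      n.Feature.Tau ≤ n.Feature.Weights 2)
    (hw10 : ∀ n ∈ NC.ListNeuro, n.Feature.Id = 1 →
      n.Feature.Tau ≤ n.Feature.Weights 0)
    (hopp : ∀ n ∈ NC.ListNeuro, n.Feature.Id = 0 →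
      n.Feature.Weights 1 = -n.Feature.Weights 2) :
    output_neuron NC (inpSI inp) 0 =
      repeat_pattern [false, true, true, false] (inp.length + 1) ∧
    output_neuron NC (inpSI inp) 1 =
      repeat_pattern [false, false, true, true] (inp.length + 1) := by
  obtain ⟨sup, len, h0, h1⟩ := hnl
  obtain ⟨⟨a, fa⟩, ⟨b, fb⟩⟩ := find_ex NC len
  have ma := List.mem_of_find?_eq_some fa
  have mb := List.mem_of_find?_eq_some fb
  have ia : a.Feature.Id = 0 := by simpa using List.find?_some fa
  have ib : b.Feature.Id = 1 := by simpa using List.find?_some fb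
  have inv : ∃ a b, NLInv (Nstepscircuit NC (inpSI inp)) inp.length a b := by
    induction inp with
    | nil =>
      obtain ⟨_, _, oa, pa⟩ := hinit a ma
      obtain ⟨_, _, ob, pb⟩ := hinit b mb
      refine ⟨a, b, len, sup, fa, fb, ?_, hopp a ma ia, hw02 a ma ia, hw10 b mb ib, ?_,
        (h1 b mb ib).2, oa, ob, pa, pb⟩
      · have := a.Feature.WId
        rwa [ia] at this
      · have := b.Feature.WId
        rwa [ib] at this
    | cons c tl ih =>
      obtain ⟨a', b', h⟩ := ih (fun x hx => ht x (List.mem_cons_of_mem _ hx))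
      obtain rfl : c = true := ht c List.mem_cons_self
      exact ⟨_, _, h.step⟩
  obtain ⟨a', b', h⟩ := inv
  simp only [output_neuron, h.fa, h.fb]
  exact ⟨h.oa, h.ob⟩
end

section
/- (Winner takes all in contralateral inhibition.) For every neuronal circuit NC and input list inp : List (ℕ → Bool), if ContraInhib(NC), is_initial_Cir(NC), every element b of inp satisfies b(2) = true and b(3) = true, w_{N_0}(1) + w_{N_0}(2) ≥ τ_{N_0}, w_{N_1}(3) ≥ τ_{N_1}, and w_{N_1}(0) + w_{N_1}(3) ≤ 0, then output_NC(N_0, inp) = repeat(true, length(inp)) ++ [false], and output_NC(N_1, inp) = [false] if length(inp) = 0, and output_NC(N_1, inp) = repeat(false, length(inp) − 1) ++ [true; false] otherwise. -/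
def ContraInhib (c : NeuroCircuit) : Prop :=
  c.SupplInput = 2 ∧ c.ListNeuro.length = 2 ∧
  (∀ n ∈ c.ListNeuro, n.Feature.Id = 0 →
    n.Feature.Weights 1 < 0 ∧ 0 < n.Feature.Weights 2 ∧ n.Feature.Weights 3 = 0) ∧
  (∀ n ∈ c.ListNeuro, n.Feature.Id = 1 →
    n.Feature.Weights 0 < 0 ∧ n.Feature.Weights 2 = 0 ∧ 0 < n.Feature.Weights 3)

theorem CI_pot (w : ℕ → ℚ) (f : ℕ → Bool) :
    potential w f 4 = (if f 0 then w 0 else 0) + (if f 1 then w 1 else 0) +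
      (if f 2 then w 2 else 0) + (if f 3 then w 3 else 0) := by
  simp only [potential]
  cases f 0 <;> cases f 1 <;> cases f 2 <;> cases f 3 <;> simp

theorem CI_next (N : Neuron) (f : ℕ → Bool) :
    NextPotential N f 4 = potential N.Feature.Weights f 4 +
      (if N.Feature.Tau ≤ N.CurPot then 0 else N.Feature.Leak_Factor * N.CurPot) := by
  unfold NextPotential
  split_ifs <;> simp

theorem CI_aux (NC : NeuroCircuit) (n0 n1 : Neuron)
    (hS : NC.SupplInput = 2) (hL : NC.ListNeuro.length = 2)
    (h0 : NC.ListNeuro.find? (fun x => x.Feature.Id == 0) = some n0)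
    (h1 : NC.ListNeuro.find? (fun x => x.Feature.Id == 1) = some n1)
    (o0 : n0.Output = [false]) (o1 : n1.Output = [false])
    (p0 : n0.CurPot = 0) (p1 : n1.CurPot = 0)
    (w00 : n0.Feature.Weights 0 = 0)
    (w01 : n0.Feature.Weights 1 < 0) (w03 : n0.Feature.Weights 3 = 0)
    (w0 : n0.Feature.Tau ≤ n0.Feature.Weights 1 + n0.Feature.Weights 2)
    (w11 : n1.Feature.Weights 1 = 0) (w12 : n1.Feature.Weights 2 = 0)
    (w1 : n1.Feature.Tau ≤ n1.Feature.Weights 3)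
    (w1' : n1.Feature.Weights 0 + n1.Feature.Weights 3 ≤ 0)
    (inp : List (ℕ → Bool)) (ht : ∀ b ∈ inp, b 2 = true ∧ b 3 = true) :
    (Nstepscircuit NC inp).SupplInput = 2 ∧ (Nstepscircuit NC inp).ListNeuro.length = 2 ∧
    ∃ m0 m1 : Neuron,
      (Nstepscircuit NC inp).ListNeuro.find? (fun x => x.Feature.Id == 0) = some m0 ∧
      (Nstepscircuit NC inp).ListNeuro.find? (fun x => x.Feature.Id == 1) = some m1 ∧
      m0.Feature = n0.Feature ∧ m1.Feature = n1.Feature ∧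
      m0.Output = List.replicate inp.length true ++ [false] ∧
      m1.Output = (if inp.length = 0 then [false] else
        List.replicate (inp.length - 1) false ++ [true, false]) ∧
      (m0.CurPot = 0 ∨ n0.Feature.Tau ≤ m0.CurPot) ∧
      (if inp.length = 0 then m1.CurPot = 0 else
        (m1.CurPot ≤ 0 ∨ n1.Feature.Tau ≤ m1.CurPot)) := by
  induction inp with
  | nil => exact ⟨hS, hL, n0, n1, h0, h1, rfl, rfl, by simpa using o0, by simpa using o1,
      Or.inl p0, by simpa using p1⟩
  | cons b tl ih =>
    obtain ⟨iS, iL, m0, m1, f0, f1, F0, F1, O0, O1, P0, P1⟩ :=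
      ih (fun c hc => ht c (List.mem_cons_of_mem _ hc))
    obtain ⟨b2, b3⟩ := ht b List.mem_cons_self
    simp only [Nstepscircuit]
    generalize Nstepscircuit NC tl = C at *
    have t0 := n0.Feature.PosTau
    have t1 := n1.Feature.PosTau
    obtain ⟨lk0, -⟩ := n1.Feature.LeakRange
    have e0 : NextPotential m0 (fun x => if x < C.ListNeuro.length then
        (output_neuron_init C x).headD false else b x) (lenNC C)
        = (if m1.Output.headD false then n0.Feature.Weights 1 else 0) + n0.Feature.Weights 2 := by
      have : (if m0.Feature.Tau ≤ m0.CurPot then 0 else m0.Feature.Leak_Factor * m0.CurPot) = 0 := by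
        rw [F0]; rcases P0 with h | h <;> simp [h]
      have hl : lenNC C = 4 := by rw [lenNC, iS, iL]
      rw [hl, CI_next, CI_pot, this, F0]
      simp [iL, output_neuron_init, f0, f1, b2, b3, w00, w03]
    have e1 : NextPotential m1 (fun x => if x < C.ListNeuro.length then
        (output_neuron_init C x).headD false else b x) (lenNC C)
        = (if m0.Output.headD false then n1.Feature.Weights 0 else 0) + n1.Feature.Weights 3
          + (if n1.Feature.Tau ≤ m1.CurPot then 0 else n1.Feature.Leak_Factor * m1.CurPot) := by
      have hl : lenNC C = 4 := by rw [lenNC, iS, iL]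
      rw [hl, CI_next, CI_pot, F1]
      simp [iL, output_neuron_init, f0, f1, b2, b3, w11, w12]
    have c0 : n0.Feature.Tau ≤ NextPotential m0 (fun x => if x < C.ListNeuro.length then
        (output_neuron_init C x).headD false else b x) (lenNC C) := by
      rw [e0]; split_ifs <;> linarith
    refine ⟨iS, by simpa [NextStepC, NextListNeuro] using iL,
      NextNeuroInNC C b m0, NextNeuroInNC C b m1, ?_, ?_, F0, F1, ?_, ?_, Or.inr c0, ?_⟩
    · simp only [NextStepC, NextListNeuro, List.find?_map]
      exact congrArg (Option.map (NextNeuroInNC C b)) f0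
    · simp only [NextStepC, NextListNeuro, List.find?_map]
      exact congrArg (Option.map (NextNeuroInNC C b)) f1
    · simp only [NextNeuroInNC, NextNeuron, F0, c0, O0, List.length_cons, List.replicate_succ]
      simp
    all_goals
      simp only [NextNeuroInNC, NextNeuron, F1, e1, List.length_cons]
      cases tl with
      | nil => simp_all
      | cons c tl =>
        have hp : (if n1.Feature.Tau ≤ m1.CurPot then 0 else
            n1.Feature.Leak_Factor * m1.CurPot) ≤ 0 := by
          simp only [List.length_cons, Nat.add_eq_zero_iff, one_ne_zero, and_false, if_false] at P1
          split_ifs with h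
          · exact le_refl _
          · exact mul_nonpos_of_nonneg_of_nonpos lk0 (P1.resolve_right h)
        have hh : m0.Output.headD false = true := by
          rw [O0]; simp [List.replicate_succ]
        rw [hh]
        simp only [if_true]
        have hlt : n1.Feature.Weights 0 + n1.Feature.Weights 3 +
          (if n1.Feature.Tau ≤ m1.CurPot then 0 else
            n1.Feature.Leak_Factor * m1.CurPot) ≤ 0 := by linarith
        first
        | exact Or.inl hlt
        | (rw [decide_eq_false (not_le.mpr (lt_of_le_of_lt hlt t1)), O1]
           simp [List.replicate_succ])

theorem CI_find (l : List Neuron) (hl : l.length = 2)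
    (hd : l.Pairwise (fun a b => a.Feature.Id ≠ b.Feature.Id))
    (hi : ∀ n ∈ l, n.Feature.Id < l.length) (k : ℕ) (hk : k < 2) :
    ∃ n ∈ l, n.Feature.Id = k ∧ l.find? (fun x => x.Feature.Id == k) = some n := by
  match l, hl with
  | [a, b], _ =>
    simp at hd hi
    by_cases h : a.Feature.Id = k
    · exact ⟨a, by simp, h, by simp [h]⟩
    · have : b.Feature.Id = k := by omega
      exact ⟨b, by simp, this, by simp [h, this]⟩

theorem CI_Winner_Takes_All (NC : NeuroCircuit) (inp : List (ℕ → Bool))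
    (hci : ContraInhib NC)
    (hinit : is_initial_Cir NC)
    (ht : ∀ b ∈ inp, b 2 = true ∧ b 3 = true)
    (hw0 : ∀ n ∈ NC.ListNeuro, n.Feature.Id = 0 →
      n.Feature.Tau ≤ n.Feature.Weights 1 + n.Feature.Weights 2)
    (hw1 : ∀ n ∈ NC.ListNeuro, n.Feature.Id = 1 →
      n.Feature.Tau ≤ n.Feature.Weights 3 ∧
      n.Feature.Weights 0 + n.Feature.Weights 3 ≤ 0) :
    output_neuron NC inp 0 = List.replicate inp.length true ++ [false] ∧
    (inp.length = 0 → output_neuron NC inp 1 = [false]) ∧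
    (inp.length ≠ 0 →
      output_neuron NC inp 1 =
        List.replicate (inp.length - 1) false ++ [true, false]) := by
  obtain ⟨hS, hL, c0, c1⟩ := hci
  obtain ⟨n0, m0, i0, f0⟩ := CI_find _ hL NC.IdNeuroDiff NC.IdInfLen 0 (by norm_num)
  obtain ⟨n1, m1, i1, f1⟩ := CI_find _ hL NC.IdNeuroDiff NC.IdInfLen 1 (by norm_num)
  obtain ⟨a1, a2, a3⟩ := c0 n0 m0 i0
  obtain ⟨b1, b2, b3⟩ := c1 n1 m1 i1
  obtain ⟨_, -, o0, p0⟩ := hinit n0 m0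
  obtain ⟨_, -, o1, p1⟩ := hinit n1 m1
  have z0 := n0.Feature.WId
  have z1 := n1.Feature.WId
  rw [i0] at z0
  rw [i1] at z1
  obtain ⟨-, -, k0, k1, g0, g1, -, -, O0, O1, -, -⟩ := CI_aux NC n0 n1 hS hL f0 f1 o0 o1 p0 p1
    z0 a1 a3 (hw0 n0 m0 i0) z1 b2 (hw1 n1 m1 i1).1 (hw1 n1 m1 i1).2 inp ht
  simp only [output_neuron, g0, g1]
  refine ⟨O0, fun h => ?_, fun h => ?_⟩
  · rw [O1, if_pos h]
  · rw [O1, if_neg h]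
end
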